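/- arXiv:1110.6623 — 2 statements merged into one kernel-verified Lean document; each statement's English description precedes it below -/
import Mathlib

section
/- Claim 3 of Proposition A.1: Let x_1, ..., x_l in R^k (l <= k) be linearly independent, let c be a nonzero vector in span(x_1, ..., x_l), set M = (1/l) * sum_{i=1}^l x_i x_i^T, fix d with M d = c, and define the weights p_i* = |x_i^T d| / sum_j |x_j^T d|. Then c is estimable under the design xi* = {(x_i, p_i*)}: there exists e in R^k with (sum_{i=1}^l p_i* x_i x_i^T) e = c. -/
open Matrix BigOperators

/-- The information matrix of a design with points `x i` and weights `p i`. -/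
noncomputable def infoMat {k l : ℕ} (x : Fin l → Fin k → ℝ) (p : Fin l → ℝ) :
    Matrix (Fin k) (Fin k) ℝ :=
  ∑ i, p i • vecMulVec (x i) (x i)

/-- The optimal weight `p_i* = |x_iᵀ d| / ∑ j |x_jᵀ d|`, where `d` solves `M d = c`. -/
noncomputable def pStar {k l : ℕ} (x : Fin l → Fin k → ℝ) (d : Fin k → ℝ) (i : Fin l) : ℝ :=
  |x i ⬝ᵥ d| / ∑ j, |x j ⬝ᵥ d|

/-- A linear system whose coefficient vectors are linearly independent is solvable. -/
theorem exists_dotProduct_eq_of_linearIndependent {k l : ℕ} {x : Fin l → Fin k → ℝ}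
    (hx : LinearIndependent ℝ x) (b : Fin l → ℝ) : ∃ e : Fin k → ℝ, ∀ i, x i ⬝ᵥ e = b i := by
  have hrank : (Matrix.of x).rank = Fintype.card (Fin l) := LinearIndependent.rank_matrix hx
  have htop : LinearMap.range (Matrix.of x).mulVecLin = ⊤ :=
    Submodule.eq_top_of_finrank_eq (by simpa [Matrix.rank] using hrank)
  obtain ⟨e, he⟩ := LinearMap.range_eq_top.mp htop b
  exact ⟨e, fun i => congrFun he i⟩

theorem infoMat_mulVec {k l : ℕ} (x : Fin l → Fin k → ℝ) (p : Fin l → ℝ) (e : Fin k → ℝ) :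
    infoMat x p *ᵥ e = ∑ i, (p i * (x i ⬝ᵥ e)) • x i := by
  simp [infoMat, Matrix.sum_mulVec, Matrix.smul_mulVec, vecMulVec_mulVec, smul_smul]

theorem dotProduct_eq_zero_of_pStar_eq_zero {k l : ℕ} {x : Fin l → Fin k → ℝ} {d : Fin k → ℝ}
    {i : Fin l} (h : pStar x d i = 0) : x i ⬝ᵥ d = 0 := by
  rcases div_eq_zero_iff.mp h with h | h
  · exact abs_eq_zero.mp h
  · exact abs_eq_zero.mp
      ((Finset.sum_eq_zero_iff_of_nonneg fun j _ => abs_nonneg (x j ⬝ᵥ d)).mp h i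
        (Finset.mem_univ i))

/-- Claim 3 of Proposition A.1: `c` is estimable under the design
`ξ* = {(x_i, p_i*)}`: there exists `e` with `(∑ i p_i* x_i x_iᵀ) e = c`. -/
theorem estimable_under_xiStar {k l : ℕ} (hk : 1 ≤ k) (hl : l ≤ k)
    (x : Fin l → Fin k → ℝ) (hxLI : LinearIndependent ℝ x)
    (c : Fin k → ℝ) (hc : c ≠ 0) (hcspan : c ∈ Submodule.span ℝ (Set.range x))
    (M : Matrix (Fin k) (Fin k) ℝ) (hM : M = (l : ℝ)⁻¹ • ∑ i, vecMulVec (x i) (x i))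
    (d : Fin k → ℝ) (hd : M *ᵥ d = c) :
    ∃ e : Fin k → ℝ, (infoMat x (pStar x d)) *ᵥ e = c := by
  obtain ⟨e, he⟩ := exists_dotProduct_eq_of_linearIndependent hxLI
    fun i => (l : ℝ)⁻¹ * (x i ⬝ᵥ d) / pStar x d i
  have hM' : M = infoMat x fun _ => (l : ℝ)⁻¹ := by
    rw [hM, infoMat, Finset.smul_sum]
  refine ⟨e, ?_⟩
  rw [← hd, hM', infoMat_mulVec, infoMat_mulVec]
  refine Finset.sum_congr rfl fun i _ => ?_
  rw [he, mul_div_cancel_of_imp']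
  intro h
  rw [dotProduct_eq_zero_of_pStar_eq_zero h, mul_zero]
end

section
/- Remark 1 (general weights version of Claim 5): Let x_1, ..., x_l in R^k (l <= k) be linearly independent, let c be a nonzero vector in span(x_1, ..., x_l), let a_1, ..., a_l be arbitrary strictly positive constants (not necessarily summing to 1), set M_a = sum_{i=1}^l a_i x_i x_i^T, and fix d_a with M_a d_a = c. Define the weights p_i^a = a_i |x_i^T d_a| / sum_j a_j |x_j^T d_a|. Then the design {(x_i, p_i^a)} minimizes Psi over all designs supported on {x_1, ..., x_l}: for every choice of weights p_1, ..., p_l >= 0 with sum_i p_i = 1 such that c is estimable under xi = {(x_i, p_i)}, one has Psi({(x_i, p_i^a)}) <= Psi(xi). -/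
open Matrix BigOperators

theorem sum_smul_vecMulVec_mulVec {ι n : Type*} [Fintype ι] [Fintype n]
    (x : ι → n → ℝ) (p : ι → ℝ) (d : n → ℝ) :
    (∑ i, p i • vecMulVec (x i) (x i)) *ᵥ d = ∑ i, (p i * (x i ⬝ᵥ d)) • x i := by
  rw [Matrix.sum_mulVec]
  refine Finset.sum_congr rfl fun i _ => ?_
  rw [Matrix.smul_mulVec, vecMulVec_mulVec, op_smul_eq_smul, smul_smul]

theorem LinearIndependent.exists_dotProduct_eq {ι n : Type*} [Fintype ι] [Fintype n]
    {x : ι → n → ℝ} (hx : LinearIndependent ℝ x) (u : ι → ℝ) :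
    ∃ d : n → ℝ, ∀ i, x i ⬝ᵥ d = u i := by
  have hrank : (Matrix.of x).rank = Fintype.card ι := LinearIndependent.rank_matrix hx
  have htop : LinearMap.range (Matrix.of x).mulVecLin = ⊤ := by
    apply Submodule.eq_top_of_finrank_eq
    rw [Module.finrank_fintype_fun_eq_card]
    exact hrank
  obtain ⟨d, hd⟩ := LinearMap.range_eq_top.mp htop u
  exact ⟨d, fun i => congrFun hd i⟩

/-- Cauchy-Schwarz with weights of total mass one. -/
theorem sq_sum_weight_mul_abs_le {ι : Type*} [Fintype ι] (p u : ι → ℝ)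
    (hp : ∀ i, 0 ≤ p i) (hsum : ∑ i, p i = 1) :
    (∑ i, p i * |u i|) ^ 2 ≤ ∑ i, p i * u i ^ 2 := by
  simpa only [smul_eq_mul, sq_abs] using
    (even_two.convexOn_pow (𝕜 := ℝ)).map_sum_le (t := Finset.univ) (w := p)
      (p := fun i => |u i|) (fun i _ => hp i) hsum (fun _ _ => Set.mem_univ _)

/-- Remark 1, general-weights version of Claim 5: for arbitrary strictly
positive constants `a_i` (not necessarily summing to 1), with `M_a = ∑ i a_i x_i x_iᵀ`,
`M_a d_a = c`, and weights `p_iᵃ = a_i |x_iᵀ d_a| / ∑ j a_j |x_jᵀ d_a|`, the design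
`{(x_i, p_iᵃ)}` minimizes `Ψ` over all designs supported on `{x₁,…,x_l}` under which `c`
is estimable.  Here `Ψ(ξ) = cᵀ d` for any `d` with `M(ξ) d = c`. -/
theorem general_weights_minimize_Psi {k l : ℕ} (hk : 1 ≤ k) (hl : l ≤ k)
    (x : Fin l → Fin k → ℝ) (hxLI : LinearIndependent ℝ x)
    (c : Fin k → ℝ) (hc : c ≠ 0) (hcspan : c ∈ Submodule.span ℝ (Set.range x))
    (a : Fin l → ℝ) (ha : ∀ i, 0 < a i)
    (Ma : Matrix (Fin k) (Fin k) ℝ) (hMa : Ma = ∑ i, a i • vecMulVec (x i) (x i))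
    (da : Fin k → ℝ) (hda : Ma *ᵥ da = c)
    (pa : Fin l → ℝ)
    (hpa : ∀ i, pa i = a i * |x i ⬝ᵥ da| / ∑ j, a j * |x j ⬝ᵥ da|) :
    (∃ dStar : Fin k → ℝ, (infoMat x pa) *ᵥ dStar = c) ∧
    ∀ dStar : Fin k → ℝ, (infoMat x pa) *ᵥ dStar = c →
      ∀ p : Fin l → ℝ, (∀ i, 0 ≤ p i) → ∑ i, p i = 1 →
        ∀ dξ : Fin k → ℝ, (infoMat x p) *ᵥ dξ = c →
          c ⬝ᵥ dStar ≤ c ⬝ᵥ dξ := by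
  set b : Fin l → ℝ := fun i => a i * (x i ⬝ᵥ da) with hb
  set S : ℝ := ∑ j, |b j| with hS
  have hcb : c = ∑ i, b i • x i := by
    rw [← hda, hMa, sum_smul_vecMulVec_mulVec]
  have habs : ∀ i, a i * |x i ⬝ᵥ da| = |b i| := fun i => by
    rw [hb, abs_mul, abs_of_pos (ha i)]
  have hpb : ∀ i, pa i = |b i| / S := fun i => by
    rw [hpa, habs, hS, Finset.sum_congr rfl fun j _ => habs j]
  have hSne : S ≠ 0 := by
    intro h
    have hzero := (Finset.sum_eq_zero_iff_of_nonneg fun j _ => abs_nonneg (b j)).mp h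
    refine hc (hcb.trans (Finset.sum_eq_zero fun i hi => ?_))
    rw [abs_eq_zero.mp (hzero i hi), zero_smul]
  have hcdot : ∀ d, c ⬝ᵥ d = ∑ i, b i * (x i ⬝ᵥ d) := fun d => by
    rw [hcb, sum_dotProduct]
    simp only [smul_dotProduct, smul_eq_mul]
  have hest : ∀ p d, infoMat x p *ᵥ d = c ↔ ∀ i, p i * (x i ⬝ᵥ d) = b i := fun p d => by
    rw [infoMat, sum_smul_vecMulVec_mulVec, hcb]
    constructor
    · intro h
      exact fun i => Fintype.linearIndependent_iffₛ.mp hxLI _ _ h i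
    · intro h
      simp only [h]
  constructor
  · obtain ⟨d, hd⟩ := hxLI.exists_dotProduct_eq fun i => S * SignType.sign (b i)
    refine ⟨d, (hest pa d).mpr fun i => ?_⟩
    rw [hpb, hd, ← mul_assoc, div_mul_cancel₀ _ hSne, abs_mul_sign]
  · intro dStar hStar p hp hsum dξ hξ
    rw [hest] at hStar hξ
    have hvalue : c ⬝ᵥ dStar = S ^ 2 := by
      rw [hcdot, sq, hS, Finset.mul_sum, ← hS]
      refine Finset.sum_congr rfl fun i _ => ?_
      have h := hStar i
      rw [hpb, div_mul_eq_mul_div, div_eq_iff hSne] at h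
      rcases eq_or_ne (b i) 0 with h0 | h0
      · simp [h0]
      · refine mul_left_cancel₀ (abs_ne_zero.mpr h0) ?_
        calc |b i| * (b i * (x i ⬝ᵥ dStar)) = b i ^ 2 * S := by linear_combination b i * h
          _ = |b i| * (S * |b i|) := by rw [← sq_abs (b i)]; ring
    have hSp : S = ∑ i, p i * |x i ⬝ᵥ dξ| := Finset.sum_congr rfl fun i _ => by
      rw [← hξ i, abs_mul, abs_of_nonneg (hp i)]
    have hξvalue : c ⬝ᵥ dξ = ∑ i, p i * (x i ⬝ᵥ dξ) ^ 2 := by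
      rw [hcdot]
      refine Finset.sum_congr rfl fun i _ => ?_
      rw [← hξ i]
      ring
    rw [hvalue, hξvalue, hSp]
    exact sq_sum_weight_mul_abs_le p _ hp hsum
end
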